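/- arXiv:1812.07392 — 2 statements merged into one kernel-verified Lean document; each statement's English description precedes it below -/
import Mathlib

section
/- Let Λ be a right 4-Nakayama artin algebra. Then Λ is of 3rd local type, i.e. for every finitely generated indecomposable right Λ-module M, the quotient module M/rad^3(M) is indecomposable. -/
/-! Basic definitions for (right) modules over a ring: radical, socle, length,
uniserial, local, indecomposable, `n`-factor serial, right `n`-Nakayama algebras,
Nakayama algebras and almost split sequences. -/

universe u v w

section ModuleDefs

variable (A : Type v) [Ring A] (M : Type w) [AddCommGroup M] [Module A M]

/-- The composition length of a module, i.e. the Krull dimension of its submodule lattice. -/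
noncomputable def moduleLength : WithBot ℕ∞ := Order.krullDim (Submodule A M)

/-- The radical of a module: the intersection of all its maximal submodules. -/
def moduleRad : Submodule A M := sInf {N : Submodule A M | IsCoatom N}

/-- The socle of a module: the sum of all its simple submodules. -/
def moduleSoc : Submodule A M := sSup {N : Submodule A M | IsAtom N}

variable {A M}

/-- The radical of a submodule `N`, viewed as a submodule of the ambient module. -/
def radOf (N : Submodule A M) : Submodule A M :=
  Submodule.map N.subtype (moduleRad A ↥N)

/-- The socle of a submodule `N`, viewed as a submodule of the ambient module. -/
def socOf (N : Submodule A M) : Submodule A M :=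
  Submodule.map N.subtype (moduleSoc A ↥N)

variable (A M)

/-- The iterated radical `rad^n(M)`, as a submodule of `M`. -/
def radPow : ℕ → Submodule A M
  | 0 => ⊤
  | n + 1 => radOf (radPow n)

/-- A module is uniserial if its submodules are totally ordered by inclusion. -/
def IsUniserialModule : Prop := ∀ N P : Submodule A M, N ≤ P ∨ P ≤ N

/-- A module is local if it has a unique maximal submodule. -/
def IsLocalModule : Prop := ∃! N : Submodule A M, IsCoatom N

/-- A module is colocal if its socle is a simple submodule. -/
def IsColocalModule : Prop := IsAtom (moduleSoc A M)

/-- A module is indecomposable if it is nonzero and is not the direct sum of two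
nonzero submodules. -/
def IsIndecModule : Prop :=
  Nontrivial M ∧ ∀ N P : Submodule A M, IsCompl N P → N = ⊥ ∨ P = ⊥

/-- The Loewy length of a module: the least `n` with `rad^n(M) = 0`. -/
noncomputable def loewyLength : ℕ := sInf {n : ℕ | radPow A M n = ⊥}

/-- A module `M` of length `l` is `n`-factor serial (`l ≥ n > 1`) if it is not uniserial,
`M/rad^{l-n}(M)` is uniserial and `M/rad^{l-n+1}(M)` is not uniserial. -/
def IsNFactorSerial (n : ℕ) : Prop :=
  1 < n ∧ ¬ IsUniserialModule A M ∧
  ∃ l : ℕ, moduleLength A M = l ∧ n ≤ l ∧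
    IsUniserialModule A (M ⧸ radPow A M (l - n)) ∧
    ¬ IsUniserialModule A (M ⧸ radPow A M (l - n + 1))

/-- `M` is `n`-factor serial, where `1`-factor serial means uniserial. -/
def IsFactorSerial (n : ℕ) : Prop :=
  (n = 1 ∧ IsUniserialModule A M) ∨ IsNFactorSerial A M n

end ModuleDefs

section AlgebraDefs

variable (Λ : Type u) [Ring Λ]

/-- A ring `Λ` is right `n`-Nakayama if every finitely generated indecomposable right
`Λ`-module is `i`-factor serial for some `1 ≤ i ≤ n`, and there is at least one finitely
generated indecomposable `n`-factor serial right `Λ`-module.  Right `Λ`-modules are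
realized as left `Λᵐᵒᵖ`-modules. -/
def IsRightNNakayama (n : ℕ) : Prop :=
  (∀ M : ModuleCat.{u} Λᵐᵒᵖ, Module.Finite Λᵐᵒᵖ M → IsIndecModule Λᵐᵒᵖ M →
      ∃ i, 1 ≤ i ∧ i ≤ n ∧ IsFactorSerial Λᵐᵒᵖ M i) ∧
  ∃ M : ModuleCat.{u} Λᵐᵒᵖ, Module.Finite Λᵐᵒᵖ M ∧ IsIndecModule Λᵐᵒᵖ M ∧
    IsNFactorSerial Λᵐᵒᵖ M n

/-- A ring `Λ` is a Nakayama algebra if every finitely generated indecomposable projective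
right `Λ`-module and every finitely generated indecomposable projective left `Λ`-module is
uniserial. -/
def IsNakayamaAlgebra : Prop :=
  (∀ M : ModuleCat.{u} Λᵐᵒᵖ, Module.Finite Λᵐᵒᵖ M → Module.Projective Λᵐᵒᵖ M →
      IsIndecModule Λᵐᵒᵖ M → IsUniserialModule Λᵐᵒᵖ M) ∧
  (∀ M : ModuleCat.{u} Λ, Module.Finite Λ M → Module.Projective Λ M →
      IsIndecModule Λ M → IsUniserialModule Λ M)

end AlgebraDefs

section AlmostSplit

variable {A : Type v} [Ring A]

/-- A pair of maps `f : X → Y`, `g : Y → Z` is an almost split (Auslander-Reiten) sequence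
if `0 → X → Y → Z → 0` is a non-split short exact sequence with `X` and `Z` indecomposable,
such that every homomorphism `V → Z` from a finitely generated module which is not a split
epimorphism factors through `g`. -/
def IsAlmostSplitSequence {X Y Z : Type w} [AddCommGroup X] [Module A X]
    [AddCommGroup Y] [Module A Y] [AddCommGroup Z] [Module A Z]
    (f : X →ₗ[A] Y) (g : Y →ₗ[A] Z) : Prop :=
  Function.Injective f ∧ Function.Surjective g ∧ LinearMap.range f = LinearMap.ker g ∧
  (¬ ∃ s : Z →ₗ[A] Y, g ∘ₗ s = LinearMap.id) ∧
  IsIndecModule A X ∧ IsIndecModule A Z ∧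
  ∀ V : ModuleCat.{w} A, Module.Finite A V →
    ∀ h : V →ₗ[A] Z, (¬ ∃ s : Z →ₗ[A] V, h ∘ₗ s = LinearMap.id) →
      ∃ k : V →ₗ[A] Y, g ∘ₗ k = h

end AlmostSplit

section RadicalLemmas

variable {A : Type v} [Ring A] {M : Type w} [AddCommGroup M] [Module A M]

theorem moduleRad_ne_top [Nontrivial M] [Module.Finite A M] : moduleRad A M ≠ ⊤ := by
  obtain ⟨C, hC, -⟩ := (eq_top_or_exists_le_coatom (⊥ : Submodule A M)).resolve_left bot_ne_top
  exact fun h => hC.1 (top_le_iff.1 (h ▸ sInf_le hC))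

theorem radOf_le (N : Submodule A M) : radOf N ≤ N := Submodule.map_subtype_le _ _

theorem radOf_lt [IsNoetherian A M] {N : Submodule A M} (hN : N ≠ ⊥) : radOf N < N := by
  have : Nontrivial N := (Submodule.nontrivial_iff_ne_bot).2 hN
  refine lt_of_le_of_ne (radOf_le N) fun h => moduleRad_ne_top (A := A) (M := N) ?_
  apply Submodule.map_injective_of_injective N.injective_subtype
  simpa [radOf] using h

theorem radPow_antitone : Antitone (radPow A M) :=
  antitone_nat_of_succ_le fun n => radOf_le (radPow A M n)

theorem radPow_one_le_of_isCoatom {C : Submodule A M} (hC : IsCoatom C) :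
    radPow A M 1 ≤ C := by
  rintro _ ⟨x, hx, rfl⟩
  have hC' : IsCoatom (C.comap (radPow A M 0).subtype) := by
    rw [← isSimpleModule_iff_isCoatom] at hC ⊢
    have e : (_ ⧸ C.comap (radPow A M 0).subtype) ≃ₗ[A] (M ⧸ C) :=
      Submodule.Quotient.equiv _ _ Submodule.topEquiv (by
        ext y
        constructor
        · rintro ⟨z, hz, rfl⟩
          exact hz
        · intro hy
          exact ⟨⟨y, trivial⟩, hy, rfl⟩)
    exact IsSimpleModule.congr e
  exact (Submodule.mem_sInf.1 hx) _ hC'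

theorem le_or_le_of_isUniserialModule_quotient {K N P : Submodule A M}
    (h : IsUniserialModule A (M ⧸ K)) (hN : K ≤ N) (hP : K ≤ P) : N ≤ P ∨ P ≤ N := by
  have key : ∀ Q : Submodule A M, K ≤ Q → (Q.map K.mkQ).comap K.mkQ = Q := fun Q hQ => by
    rw [Submodule.comap_map_mkQ, sup_eq_right.2 hQ]
  rw [← key N hN, ← key P hP]
  exact (h (N.map K.mkQ) (P.map K.mkQ)).imp
    (fun h => Submodule.comap_mono h) (fun h => Submodule.comap_mono h)

theorem isIndecModule_quotient_radPow_of_isCoatom_le_or_le [Nontrivial M] [IsNoetherian A M]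
    (h : ∀ C D : Submodule A M, IsCoatom C → IsCoatom D → C ≤ D ∨ D ≤ C)
    {n : ℕ} (hn : 1 ≤ n) : IsIndecModule A (M ⧸ radPow A M n) := by
  constructor
  · rw [Submodule.Quotient.nontrivial_iff]
    exact ((radPow_antitone hn).trans_lt (radOf_lt top_ne_bot)).ne
  · generalize radPow A M n = K
    intro N P hNP
    have hinj : Function.Injective (Submodule.comap K.mkQ) :=
      Submodule.comap_injective_of_surjective K.mkQ_surjective
    have htop : N.comap K.mkQ ⊔ P.comap K.mkQ = ⊤ := by
      have hK : K ≤ N.comap K.mkQ ⊔ P.comap K.mkQ :=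
        le_sup_of_le_left (Submodule.le_comap_mkQ K N)
      rw [← sup_eq_right.2 hK, ← Submodule.comap_map_mkQ, Submodule.map_sup,
        Submodule.map_comap_eq_of_surjective K.mkQ_surjective,
        Submodule.map_comap_eq_of_surjective K.mkQ_surjective, hNP.sup_eq_top,
        Submodule.comap_top]
    rcases eq_top_or_exists_le_coatom (N.comap K.mkQ) with hN | ⟨C, hC, hNC⟩
    · right
      obtain rfl : N = ⊤ := hinj (by rw [hN, Submodule.comap_top])
      simpa only [top_inf_eq] using hNP.inf_eq_bot
    rcases eq_top_or_exists_le_coatom (P.comap K.mkQ) with hP | ⟨D, hD, hPD⟩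
    · left
      obtain rfl : P = ⊤ := hinj (by rw [hP, Submodule.comap_top])
      simpa only [inf_top_eq] using hNP.inf_eq_bot
    rcases h C D hC hD with hCD | hDC
    · exact absurd (top_le_iff.1 (htop ▸ sup_le (hNC.trans hCD) hPD)) hD.1
    · exact absurd (top_le_iff.1 (htop ▸ sup_le hNC (hPD.trans hDC))) hC.1

/-- A module of length at most `n + 1` whose top is not uniserial has Loewy length at most `n`. -/
theorem radPow_eq_bot_of_moduleLength_le [IsNoetherian A M] {n : ℕ}
    (hl : moduleLength A M ≤ (n + 1 : ℕ))
    (h : ¬ IsUniserialModule A (M ⧸ radPow A M 1)) : radPow A M n = ⊥ := by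
  by_contra hbot
  obtain ⟨N, hN1, hN2⟩ : ∃ N, radPow A M 1 < N ∧ N < ⊤ := by
    simp only [IsUniserialModule, not_forall, not_or] at h
    obtain ⟨N, P, hNP, hPN⟩ := h
    have hbN : ⊥ < N := bot_lt_iff_ne_bot.2 (by rintro rfl; exact hNP bot_le)
    have hNt : N < ⊤ := lt_top_iff_ne_top.2 (by rintro rfl; exact hPN le_top)
    have hmono : StrictMono (Submodule.comap (radPow A M 1).mkQ) :=
      Monotone.strictMono_of_injective (fun _ _ h => Submodule.comap_mono h)
        (Submodule.comap_injective_of_surjective (Submodule.mkQ_surjective _))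
    exact ⟨N.comap (radPow A M 1).mkQ, by simpa using hmono hbN, by simpa using hmono hNt⟩
  have hlt : ∀ k ≤ n, radPow A M (k + 1) < radPow A M k := fun k hk =>
    radOf_lt fun h0 => hbot (le_bot_iff.1 (h0 ▸ radPow_antitone hk))
  let f : ℕ → Submodule A M
    | 0 => ⊤
    | 1 => N
    | k + 2 => radPow A M (k + 1)
  have hf : ∀ k, k < n + 2 → f (k + 1) < f k := by
    rintro (_ | _ | k) hk
    · exact hN2
    · exact hN1
    · exact hlt (k + 1) (by omega)
  let s : LTSeries (Submodule A M) :=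
    { length := n + 2
      toFun := fun i => f (n + 2 - i)
      step := fun i => by
        have := hf (n + 2 - (i + 1)) (by omega)
        have hi : n + 2 - (i + 1 : ℕ) + 1 = n + 2 - i := by omega
        rw [hi] at this
        simpa using this }
  have := (Order.LTSeries.length_le_krullDim s).trans hl
  simp only [s] at this
  norm_cast at this
  omega

end RadicalLemmas

theorem right_four_nakayama_is_third_local_type
    (R : Type*) [CommRing R] [IsArtinianRing R]
    (Λ : Type u) [Ring Λ] [Algebra R Λ] [Module.Finite R Λ]
    (hΛ : IsRightNNakayama Λ 4)
    (M : Type u) [AddCommGroup M] [Module Λᵐᵒᵖ M] [Module.Finite Λᵐᵒᵖ M]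
    (hM : IsIndecModule Λᵐᵒᵖ M) :
    IsIndecModule Λᵐᵒᵖ (M ⧸ radPow Λᵐᵒᵖ M 3) := by
  have : IsNoetherianRing Λᵐᵒᵖ := IsNoetherianRing.of_finite R Λᵐᵒᵖ
  have := hM.1
  obtain ⟨i, -, hi, hserial⟩ := hΛ.1 (ModuleCat.of Λᵐᵒᵖ M) ‹_› hM
  rcases hserial with ⟨-, huni⟩ | ⟨-, -, l, hl, -, huni, hnot⟩
  · exact isIndecModule_quotient_radPow_of_isCoatom_le_or_le (fun C D _ _ => huni C D) (by norm_num)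
  change moduleLength Λᵐᵒᵖ M = l at hl
  change IsUniserialModule Λᵐᵒᵖ (M ⧸ radPow Λᵐᵒᵖ M (l - i)) at huni
  change ¬ IsUniserialModule Λᵐᵒᵖ (M ⧸ radPow Λᵐᵒᵖ M (l - i + 1)) at hnot
  rcases Nat.eq_zero_or_pos (l - i) with h0 | hpos
  · rw [h0] at hnot
    have hbot : radPow Λᵐᵒᵖ M 3 = ⊥ :=
      radPow_eq_bot_of_moduleLength_le
        (by rw [hl]; exact_mod_cast (by omega : l ≤ 4)) hnot
    let e := (Submodule.quotEquivOfEqBot _ hbot).symm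
    let o := Submodule.orderIsoMapComap e
    refine ⟨e.symm.toEquiv.nontrivial, fun N P hNP => ?_⟩
    simpa using hM.2 _ _ (o.symm.isCompl hNP)
  · have hle {C : Submodule Λᵐᵒᵖ M} (hC : IsCoatom C) : radPow Λᵐᵒᵖ M (l - i) ≤ C :=
      (radPow_antitone hpos).trans (radPow_one_le_of_isCoatom hC)
    exact isIndecModule_quotient_radPow_of_isCoatom_le_or_le
      (fun C D hC hD => le_or_le_of_isUniserialModule_quotient huni (hle hC) (hle hD))
      (by norm_num)
end

section
/- Let Λ be a right 4-Nakayama artin algebra and let M be a finitely generated indecomposable local right Λ-module. If M is 2-factor serial, then l(M) = 3. -/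
/-! Basic definitions for (right) modules over a ring: radical, socle, length,
uniserial, local, indecomposable, `n`-factor serial, right `n`-Nakayama algebras,
Nakayama algebras and almost split sequences. -/

universe u v w

namespace JacobsonFiltration

open Submodule

section Radical

variable {A : Type v} [Ring A] {M : Type w} [AddCommGroup M] [Module A M]

/-- Nakayama's lemma, in the form that `J • X` is superfluous in `X`. -/
lemma le_of_le_jacobson_smul_sup {X K : Submodule A M} (fg : X.FG)
    (h : X ≤ Ring.jacobson A • X ⊔ K) : X ≤ K := by
  have h' : X.map K.mkQ ≤ Ring.jacobson A • X.map K.mkQ := by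
    rw [← map_smul'']
    refine (map_mono h).trans ?_
    rw [Submodule.map_sup, mkQ_map_self, sup_bot_eq]
  have h0 := (fg.map K.mkQ).eq_bot_of_le_jacobson_smul h'
  rwa [← le_bot_iff, map_le_iff_le_comap, comap_bot, ker_mkQ] at h0

lemma eq_of_not_le_of_jacobson_smul_covBy {X K : Submodule A M} (fg : X.FG)
    (hX : Ring.jacobson A • X ⩿ X) (hK : K ≤ X) (h : ¬ K ≤ Ring.jacobson A • X) : K = X := by
  refine le_antisymm hK (le_of_le_jacobson_smul_sup fg ?_)
  by_contra hlt
  refine hX.2 (lt_of_le_of_ne (le_sup_left (b := K)) fun he => h ?_)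
    (lt_of_le_not_ge (sup_le hX.le hK) hlt)
  exact le_sup_right.trans he.ge

lemma isSemisimpleModule_of_jacobson_smul_eq_bot [IsSemiprimaryRing A]
    (h : Ring.jacobson A • (⊤ : Submodule A M) = ⊥) : IsSemisimpleModule A M := by
  have h : Module.IsTorsionBySet A M (Ring.jacobson A) := fun m a =>
    (mem_bot A).1 (h ▸ smul_mem_smul a.2 mem_top)
  let _ := h.module
  exact h.isSemisimpleModule_iff.1 inferInstance

lemma moduleRad_eq [IsSemiprimaryRing A] :
    moduleRad A M = Ring.jacobson A • (⊤ : Submodule A M) := by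
  refine le_antisymm ?_ (Ring.jacobson_smul_top_le A M)
  refine Module.jacobson_le_of_eq_bot ?_
  have : IsSemisimpleModule A (M ⧸ Ring.jacobson A • (⊤ : Submodule A M)) := by
    refine isSemisimpleModule_of_jacobson_smul_eq_bot ?_
    rw [← range_mkQ, ← Submodule.map_top, ← map_smul'', mkQ_map_self]
  exact IsSemisimpleModule.jacobson_eq_bot A _

lemma radOf_eq [IsSemiprimaryRing A] (X : Submodule A M) :
    radOf X = Ring.jacobson A • X := by
  rw [radOf, moduleRad_eq, map_smul'', Submodule.map_top, range_subtype]

lemma radPow_succ [IsSemiprimaryRing A] (n : ℕ) :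
    radPow A M (n + 1) = Ring.jacobson A • radPow A M n :=
  radOf_eq _

lemma radPow_antitone [IsSemiprimaryRing A] : Antitone (radPow A M) :=
  antitone_nat_of_succ_le fun n => (radPow_succ n).trans_le smul_le_right

lemma exists_isCompl_of_jacobson_smul_eq_bot [IsSemiprimaryRing A] {X K : Submodule A M}
    (hX : Ring.jacobson A • X = ⊥) (hK : K ≤ X) :
    ∃ K' ≤ X, K ⊓ K' = ⊥ ∧ K ⊔ K' = X := by
  have : IsSemisimpleModule A X := by
    refine isSemisimpleModule_of_jacobson_smul_eq_bot ?_
    apply map_injective_of_injective X.injective_subtype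
    rw [map_smul'', Submodule.map_top, range_subtype, hX, Submodule.map_bot]
  obtain ⟨C, hC⟩ := exists_isCompl (K.submoduleOf X)
  have hK' : (K.submoduleOf X).map X.subtype = K := by
    rw [submoduleOf, map_comap_subtype, inf_eq_right.2 hK]
  refine ⟨C.map X.subtype, map_subtype_le X C, ?_, ?_⟩
  · rw [← hK', ← map_inf _ X.injective_subtype, hC.inf_eq_bot, Submodule.map_bot]
  · rw [← hK', ← Submodule.map_sup, hC.sup_eq_top, Submodule.map_top, range_subtype]

lemma exists_isCompl_mod_jacobson_smul [IsSemiprimaryRing A] {X K : Submodule A M}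
    (h : Ring.jacobson A • X ≤ K) (hK : K ≤ X) :
    ∃ K', Ring.jacobson A • X ≤ K' ∧ K' ≤ X ∧ K ⊓ K' = Ring.jacobson A • X ∧ K ⊔ K' = X := by
  set L := Ring.jacobson A • X with hL
  have hLX : L ≤ X := h.trans hK
  obtain ⟨C, hC, h1, h2⟩ := exists_isCompl_of_jacobson_smul_eq_bot
    (X := X.map L.mkQ) (K := K.map L.mkQ) (by rw [← map_smul'', ← hL, mkQ_map_self]) (map_mono hK)
  have e : ∀ {Z : Submodule A M}, L ≤ Z → (Z.map L.mkQ).comap L.mkQ = Z := fun {Z} hZ => by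
    rw [comap_map_mkQ, sup_eq_right.2 hZ]
  refine ⟨C.comap L.mkQ, le_comap_mkQ L C, (comap_mono hC).trans (e hLX).le, ?_, ?_⟩
  · conv_lhs => rw [← e h]
    rw [← comap_inf, h1, comap_bot, ker_mkQ]
  · rw [← e (h.trans le_sup_left : L ≤ K ⊔ C.comap L.mkQ), Submodule.map_sup,
      map_comap_eq_of_surjective L.mkQ_surjective, h2, e hLX]

lemma isUniserialModule_quotient_iff {L : Submodule A M} :
    IsUniserialModule A (M ⧸ L) ↔ ∀ X Y, L ≤ X → L ≤ Y → X ≤ Y ∨ Y ≤ X := by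
  constructor
  · intro h X Y hX hY
    have e : ∀ {Z : Submodule A M}, L ≤ Z → (Z.map L.mkQ).comap L.mkQ = Z := fun {Z} hZ => by
      rw [comap_map_mkQ, sup_eq_right.2 hZ]
    rw [← e hX, ← e hY]
    exact (h (X.map L.mkQ) (Y.map L.mkQ)).imp (fun h => comap_mono h) fun h => comap_mono h
  · intro h X Y
    have := h _ _ (le_comap_mkQ L X) (le_comap_mkQ L Y)
    rwa [comap_le_comap_iff_of_surjective L.mkQ_surjective,
      comap_le_comap_iff_of_surjective L.mkQ_surjective] at this

lemma jacobson_smul_wcovBy [IsSemiprimaryRing A] {L X : Submodule A M}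
    (hL : IsUniserialModule A (M ⧸ L)) (hX : L ≤ Ring.jacobson A • X) :
    Ring.jacobson A • X ⩿ X := by
  refine ⟨smul_le_right, fun K h1 h2 => ?_⟩
  obtain ⟨C, hC, hCX, hi, hs⟩ := exists_isCompl_mod_jacobson_smul h1.le h2.le
  rcases isUniserialModule_quotient_iff.1 hL K C (hX.trans h1.le) (hX.trans hC) with h | h
  · exact h1.ne' (hi ▸ (inf_eq_left.2 h).symm)
  · exact h2.ne (hs ▸ (sup_eq_left.2 h).symm)

lemma le_radPow_or_eq [IsSemiprimaryRing A] [IsNoetherian A M] {n : ℕ}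
    (h : ∀ i < n, radPow A M (i + 1) ⩿ radPow A M i) (K : Submodule A M) :
    K ≤ radPow A M n ∨ ∃ i < n, K = radPow A M i := by
  induction n with
  | zero => exact .inl le_top
  | succ n ih =>
    rcases ih fun i hi => h i (hi.trans n.lt_succ_self) with hK | ⟨i, hi, hK⟩
    · rw [radPow_succ]
      by_cases hle : K ≤ Ring.jacobson A • radPow A M n
      · exact .inl hle
      · exact .inr ⟨n, n.lt_succ_self, eq_of_not_le_of_jacobson_smul_covBy
          (IsNoetherian.noetherian _) ((radPow_succ (A := A) (M := M) n) ▸ h n n.lt_succ_self) hK hle⟩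
    · exact .inr ⟨i, hi.trans n.lt_succ_self, hK⟩

lemma isUniserialModule_quotient_radPow [IsSemiprimaryRing A] [IsNoetherian A M] {n : ℕ}
    (h : ∀ i < n, radPow A M (i + 1) ⩿ radPow A M i) :
    IsUniserialModule A (M ⧸ radPow A M n) := by
  refine isUniserialModule_quotient_iff.2 fun X Y hX hY => ?_
  rcases le_radPow_or_eq h X with h1 | ⟨i, -, rfl⟩
  · exact .inl (h1.trans hY)
  rcases le_radPow_or_eq h Y with h2 | ⟨j, -, rfl⟩
  · exact .inr (h2.trans hX)
  exact (le_total j i).imp (fun h => radPow_antitone h) fun h => radPow_antitone h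

lemma height_radPow_add_le [IsSemiprimaryRing A] [IsNoetherian A M] {n : ℕ}
    (h : radPow A M n ≠ ⊥) :
    Order.height (radPow A M n) + n ≤ Order.height (⊤ : Submodule A M) := by
  induction n with
  | zero => simp [radPow]
  | succ n ih =>
    have hn : radPow A M n ≠ ⊥ := fun h0 => h (by rw [radPow_succ, h0, smul_bot])
    have hlt : radPow A M (n + 1) < radPow A M n := by
      rw [radPow_succ]
      exact (IsNoetherian.noetherian (radPow A M n)).jacobson_smul_lt hn
    calc Order.height (radPow A M (n + 1)) + ((n + 1 : ℕ) : ℕ∞)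
        = Order.height (radPow A M (n + 1)) + 1 + n := by push_cast; ring
      _ ≤ Order.height (radPow A M n) + n := by gcongr; exact Order.height_add_one_le hlt
      _ ≤ _ := ih hn

end Radical

section Subquotient

variable {A : Type v} [Ring A] {V : Type w} [AddCommGroup V] [Module A V]

/-- Submodules of the subquotient `W / K` correspond to the submodules between `K` and `W`. -/
def subquotientOrderIso {K W : Submodule A V} (h : K ≤ W) :
    Submodule A (W ⧸ K.submoduleOf W) ≃o Set.Icc K W where
  toFun X := ⟨(X.comap (K.submoduleOf W).mkQ).map W.subtype, by
    refine ⟨?_, map_subtype_le _ _⟩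
    refine le_trans ?_ (map_mono (le_comap_mkQ _ X))
    rw [submoduleOf, map_comap_subtype, inf_eq_right.2 h]⟩
  invFun Z := (Z.1.submoduleOf W).map (K.submoduleOf W).mkQ
  left_inv X := by
    change map _ (comap W.subtype (map W.subtype (comap (K.submoduleOf W).mkQ X))) = X
    rw [comap_map_eq_of_injective W.injective_subtype,
      map_comap_eq_of_surjective (mkQ_surjective _)]
  right_inv Z := by
    ext1
    simp only [comap_map_mkQ]
    rw [sup_eq_right.2 (comap_mono Z.2.1), submoduleOf, map_comap_subtype,
      inf_eq_right.2 Z.2.2]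
  map_rel_iff' {X Y} := by
    change map W.subtype (comap (K.submoduleOf W).mkQ X) ≤
      map W.subtype (comap (K.submoduleOf W).mkQ Y) ↔ X ≤ Y
    rw [map_le_map_iff_of_injective W.injective_subtype,
      comap_le_comap_iff_of_surjective (mkQ_surjective _)]

lemma jacobson_smul_top_le_subquotientOrderIso_symm {K W : Submodule A V} (h : K ≤ W)
    {Z : Set.Icc K W} (hZ : Ring.jacobson A • W ≤ Z) :
    Ring.jacobson A • (⊤ : Submodule A (W ⧸ K.submoduleOf W)) ≤
      (subquotientOrderIso h).symm Z := by
  refine smul_le.2 fun r hr x _ => ?_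
  obtain ⟨y, rfl⟩ := mkQ_surjective _ x
  exact ⟨r • y, hZ (smul_mem_smul hr y.2), _root_.map_smul _ _ _⟩

lemma jacobson_smul_prod {V' : Type*} [AddCommGroup V'] [Module A V'] (X : Submodule A V)
    (Y : Submodule A V') :
    Ring.jacobson A • X.prod Y = (Ring.jacobson A • X).prod (Ring.jacobson A • Y) := by
  rw [LinearMap.prod_eq_sup_map, smul_sup, ← map_smul'', ← map_smul'',
    ← LinearMap.prod_eq_sup_map]

end Subquotient

lemma five_le_of_krullDim_eq {α : Type*} [Preorder α] {l : ℕ} (h : Order.krullDim α = l)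
    {a₀ a₁ a₂ a₃ a₄ a₅ : α} (h₀ : a₀ < a₁) (h₁ : a₁ < a₂) (h₂ : a₂ < a₃) (h₃ : a₃ < a₄)
    (h₄ : a₄ < a₅) : 5 ≤ l := by
  let s : LTSeries α := ⟨5, ![a₀, a₁, a₂, a₃, a₄, a₅], fun i => by fin_cases i <;> assumption⟩
  have hs : ((s.length : ℕ) : WithBot ℕ∞) ≤ l := h ▸ Order.LTSeries.length_le_krullDim s
  exact_mod_cast hs

section Amalgam

variable {A : Type v} [Ring A] {M : Type w} [AddCommGroup M] [Module A M]

/-- A local submodule `P` of Loewy length three whose first two radical layers are simple and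
whose last one splits as `S ⊕ T`. -/
structure IsForkedChain (P Q D S T : Submodule A M) : Prop where
  smul_top : Ring.jacobson A • P = Q
  smul_mid : Ring.jacobson A • Q = D
  smul_bot : Ring.jacobson A • D = ⊥
  wcovBy_top : Q ⩿ P
  wcovBy_mid : D ⩿ Q
  inf_eq : S ⊓ T = ⊥
  sup_eq : S ⊔ T = D
  left_ne : S ≠ ⊥
  right_ne : T ≠ ⊥

/-- The relations glueing `P` to `Q / T` along `D / T ≅ S`. -/
def glueing (S T : Submodule A M) : Submodule A (M × M) :=
  S.prod ⊤ ⊓ T.comap (LinearMap.fst A M M + LinearMap.snd A M M)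

lemma mem_glueing {S T : Submodule A M} {x : M × M} :
    x ∈ glueing S T ↔ x.1 ∈ S ∧ x.1 + x.2 ∈ T := by
  simp [glueing]

namespace IsForkedChain

variable {P Q D S T : Submodule A M}

lemma left_le (h : IsForkedChain P Q D S T) : S ≤ D := le_sup_left.trans h.sup_eq.le

lemma right_le (h : IsForkedChain P Q D S T) : T ≤ D := le_sup_right.trans h.sup_eq.le

lemma not_le_left (h : IsForkedChain P Q D S T) : ¬ D ≤ S := fun hD =>
  h.right_ne (h.inf_eq ▸ (inf_eq_right.2 (h.right_le.trans hD)).symm)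

lemma not_le_right (h : IsForkedChain P Q D S T) : ¬ D ≤ T := fun hD =>
  h.left_ne (h.inf_eq ▸ (inf_eq_left.2 (h.left_le.trans hD)).symm)

lemma glueing_le (h : IsForkedChain P Q D S T) : glueing S T ≤ D.prod D := by
  intro x hx
  rw [mem_glueing] at hx
  refine ⟨h.left_le hx.1, ?_⟩
  have := D.sub_mem (h.right_le hx.2) (h.left_le hx.1)
  rwa [add_sub_cancel_left] at this

lemma prod_le_of_glueing_le (h : IsForkedChain P Q D S T) {X : Submodule A (M × M)}
    (hX : glueing S T ≤ X) (hD : D.prod ⊥ ≤ X) : D.prod D ≤ X := by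
  rintro ⟨a, b⟩ ⟨ha, hb⟩
  obtain ⟨s, hs, t, ht, rfl⟩ := mem_sup.1 (h.sup_eq.ge hb)
  have h1 : ((-s, s + t) : M × M) ∈ X := hX (mem_glueing.2 ⟨S.neg_mem hs, by simpa using ht⟩)
  have h2 : ((a + s, 0) : M × M) ∈ X :=
    hD ⟨D.add_mem ha (h.left_le hs), rfl⟩
  simpa using X.add_mem h1 h2

lemma jacobson_smul_prod_eq (h : IsForkedChain P Q D S T) :
    Ring.jacobson A • P.prod Q = Q.prod D := by
  rw [jacobson_smul_prod, h.smul_top, h.smul_mid]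

lemma glueing_le_prod (h : IsForkedChain P Q D S T) : glueing S T ≤ P.prod Q :=
  h.glueing_le.trans (prod_mono (h.wcovBy_mid.le.trans h.wcovBy_top.le) h.wcovBy_mid.le)

lemma mid_lt (h : IsForkedChain P Q D S T) : D < Q := by
  refine lt_of_le_of_ne h.wcovBy_mid.le fun he => h.left_ne ?_
  have : D = ⊥ := by rw [← h.smul_mid, ← he, h.smul_bot]
  exact le_bot_iff.1 (h.left_le.trans this.le)

lemma top_lt (h : IsForkedChain P Q D S T) : Q < P := by
  refine lt_of_le_of_ne h.wcovBy_top.le fun he => h.mid_lt.ne ?_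
  rw [← h.smul_mid, he, h.smul_top, he]

lemma five_le_length (h : IsForkedChain P Q D S T) {l : ℕ}
    (hl : moduleLength A (P.prod Q ⧸ (glueing S T).submoduleOf (P.prod Q)) = l) : 5 ≤ l := by
  have hle := h.glueing_le_prod
  have hDQ := h.wcovBy_mid.le
  have hQP := h.wcovBy_top.le
  rw [moduleLength, Order.krullDim_eq_of_orderIso (subquotientOrderIso hle)] at hl
  have h0 : glueing S T < glueing S T ⊔ S.prod ⊥ := by
    refine lt_of_le_not_ge le_sup_left fun hge => h.left_ne (le_bot_iff.1 ?_)
    rw [← h.inf_eq]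
    refine fun s hs => ⟨hs, ?_⟩
    have := mem_glueing.1 (hge (mem_sup_right (show (s, (0 : M)) ∈ S.prod ⊥ from ⟨hs, rfl⟩)))
    simpa using this.2
  have h1 : glueing S T ⊔ S.prod ⊥ < D.prod D := by
    refine lt_of_le_not_ge (sup_le h.glueing_le (prod_mono h.left_le bot_le)) fun hge =>
      h.not_le_left fun d hd => ?_
    have : glueing S T ⊔ S.prod ⊥ ≤ S.prod ⊤ := sup_le inf_le_left (prod_mono le_rfl bot_le)
    exact (this (hge (show (d, (0 : M)) ∈ D.prod D from ⟨hd, D.zero_mem⟩))).1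
  have h2 : D.prod D < Q.prod D := by
    refine lt_of_le_not_ge (prod_mono hDQ le_rfl) fun hge => h.mid_lt.not_ge fun x hx => ?_
    exact (hge (show (x, (0 : M)) ∈ Q.prod D from ⟨hx, D.zero_mem⟩)).1
  have h3 : Q.prod D < Q.prod Q := by
    refine lt_of_le_not_ge (prod_mono le_rfl hDQ) fun hge => h.mid_lt.not_ge fun x hx => ?_
    exact (hge (show ((0 : M), x) ∈ Q.prod Q from ⟨Q.zero_mem, hx⟩)).2
  have h4 : Q.prod Q < P.prod Q := by
    refine lt_of_le_not_ge (prod_mono hQP le_rfl) fun hge => h.top_lt.not_ge fun x hx => ?_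
    exact (hge (show (x, (0 : M)) ∈ P.prod Q from ⟨hx, Q.zero_mem⟩)).1
  let c (Z : Submodule A (M × M)) (h1 : glueing S T ≤ Z) (h2 : Z ≤ P.prod Q) :
    Set.Icc (glueing S T) (P.prod Q) := ⟨Z, h1, h2⟩
  exact five_le_of_krullDim_eq hl
    (a₀ := c _ le_rfl hle)
    (a₁ := c _ h0.le (h1.le.trans (h2.le.trans (h3.le.trans h4.le))))
    (a₂ := c _ h.glueing_le (h2.le.trans (h3.le.trans h4.le)))
    (a₃ := c _ (h.glueing_le.trans h2.le) (h3.le.trans h4.le))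
    (a₄ := c _ (h.glueing_le.trans (h2.le.trans h3.le)) h4.le)
    (a₅ := c _ hle le_rfl) h0 h1 h2 h3 h4

lemma not_isUniserialModule_quotient (h : IsForkedChain P Q D S T)
    {L : Submodule A (P.prod Q ⧸ (glueing S T).submoduleOf (P.prod Q))}
    (hL : L ≤ Ring.jacobson A • ⊤) : ¬ IsUniserialModule A (_ ⧸ L) := by
  intro hu
  have hle := h.glueing_le_prod
  have hDQ := h.wcovBy_mid.le
  have hQP := h.wcovBy_top.le
  have hQD : Q.prod D ≤ P.prod D := prod_mono hQP le_rfl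
  have hQD' : Q.prod D ≤ Q.prod Q := prod_mono le_rfl hDQ
  have hg : glueing S T ≤ Q.prod D := h.glueing_le.trans (prod_mono hDQ le_rfl)
  let X : Set.Icc (glueing S T) (P.prod Q) :=
    ⟨P.prod D, hg.trans hQD, prod_mono le_rfl hDQ⟩
  let Y : Set.Icc (glueing S T) (P.prod Q) :=
    ⟨Q.prod Q, hg.trans hQD', prod_mono hQP le_rfl⟩
  have hX := hL.trans (jacobson_smul_top_le_subquotientOrderIso_symm hle (Z := X)
    (h.jacobson_smul_prod_eq.le.trans hQD))
  have hY := hL.trans (jacobson_smul_top_le_subquotientOrderIso_symm hle (Z := Y)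
    (h.jacobson_smul_prod_eq.le.trans hQD'))
  rcases isUniserialModule_quotient_iff.1 hu _ _ hX hY with hc | hc
  · have hc : P.prod D ≤ Q.prod Q := (subquotientOrderIso hle).symm.le_iff_le.1 hc
    exact h.top_lt.not_ge fun x hx =>
      (hc (show (x, (0 : M)) ∈ P.prod D from ⟨hx, D.zero_mem⟩)).1
  · have hc : Q.prod Q ≤ P.prod D := (subquotientOrderIso hle).symm.le_iff_le.1 hc
    exact h.mid_lt.not_ge fun x hx =>
      (hc (show ((0 : M), x) ∈ Q.prod Q from ⟨Q.zero_mem, hx⟩)).2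

lemma five_le_of_isFactorSerial [IsSemiprimaryRing A] (h : IsForkedChain P Q D S T) {n : ℕ}
    (hn : IsFactorSerial A (P.prod Q ⧸ (glueing S T).submoduleOf (P.prod Q)) n) : 5 ≤ n := by
  rcases hn with ⟨-, hu⟩ | ⟨-, -, l, hl, hnl, hu, -⟩
  · refine absurd ?_ (h.not_isUniserialModule_quotient bot_le)
    exact isUniserialModule_quotient_iff.2 fun X Y _ _ => hu X Y
  · by_contra! hlt
    have h5 := h.five_le_length hl
    refine h.not_isUniserialModule_quotient ?_ hu
    refine (radPow_antitone (show 1 ≤ l - n by omega)).trans ?_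
    rw [radPow_succ, radPow]

variable [IsNoetherian A M]

lemma eq_of_glueing_le (h : IsForkedChain P Q D S T) {X : Submodule A (M × M)}
    (hX : glueing S T ≤ X) (hXQ : X ≤ Q.prod D) (hXD : ¬ X ≤ D.prod D) : X = Q.prod D := by
  have hfst : X.map (LinearMap.fst A M M) = Q := by
    refine eq_of_not_le_of_jacobson_smul_covBy (IsNoetherian.noetherian Q)
      (h.smul_mid.symm ▸ h.wcovBy_mid) (map_le_iff_le_comap.2 fun x hx => (hXQ hx).1) ?_
    rw [h.smul_mid]
    exact fun hle => hXD fun x hx => ⟨hle (mem_map_of_mem hx), (hXQ hx).2⟩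
  have hD : D.prod ⊥ ≤ X := by
    rintro ⟨a, b⟩ ⟨ha, hb⟩
    rw [SetLike.mem_coe, ← h.smul_mid, ← hfst, ← map_smul''] at ha
    obtain ⟨y, hy, rfl⟩ := ha
    have hy' := smul_mono_right (Ring.jacobson A) hXQ hy
    rw [jacobson_smul_prod, h.smul_bot] at hy'
    have : y = (y.1, b) := Prod.ext rfl (((mem_bot A).1 hy'.2).trans ((mem_bot A).1 hb).symm)
    rw [LinearMap.fst_apply, ← this]
    exact smul_le_right hy
  refine le_antisymm hXQ ?_
  rintro ⟨a, b⟩ ⟨ha, hb⟩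
  rw [SetLike.mem_coe, ← hfst] at ha
  obtain ⟨y, hy, rfl⟩ := ha
  have : ((0, b - y.2) : M × M) ∈ X := h.prod_le_of_glueing_le hX hD
    ⟨D.zero_mem, D.sub_mem hb (hXQ hy).2⟩
  convert! X.add_mem hy this using 1
  simp [Prod.ext_iff]

lemma le_prod_of_jacobson_smul_le (h : IsForkedChain P Q D S T) {X : Submodule A (M × M)}
    (hX : X ≤ P.prod Q) (hJ : Ring.jacobson A • X ≤ glueing S T) : X ≤ D.prod D := by
  have hS : Ring.jacobson A • X.map (LinearMap.fst A M M) ≤ S := by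
    rw [← map_smul'', map_le_iff_le_comap]
    exact fun x hx => (mem_glueing.1 (hJ hx)).1
  have h1 : X.map (LinearMap.fst A M M) ≤ P := map_le_iff_le_comap.2 fun x hx => (hX hx).1
  have h2 : X.map (LinearMap.snd A M M) ≤ Q := map_le_iff_le_comap.2 fun x hx => (hX hx).2
  have hfst : X.map (LinearMap.fst A M M) ≤ D := by
    have hQ : X.map (LinearMap.fst A M M) ≤ Q := by
      by_contra hc
      have := eq_of_not_le_of_jacobson_smul_covBy (IsNoetherian.noetherian P)
        (h.smul_top.symm ▸ h.wcovBy_top) h1 (h.smul_top.symm ▸ hc)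
      rw [this, h.smul_top] at hS
      exact h.not_le_left (h.wcovBy_mid.le.trans hS)
    by_contra hc
    have := eq_of_not_le_of_jacobson_smul_covBy (IsNoetherian.noetherian Q)
      (h.smul_mid.symm ▸ h.wcovBy_mid) hQ (h.smul_mid.symm ▸ hc)
    rw [this, h.smul_mid] at hS
    exact h.not_le_left hS
  have hsnd : X.map (LinearMap.snd A M M) ≤ D := by
    by_contra hc
    have hQ := eq_of_not_le_of_jacobson_smul_covBy (IsNoetherian.noetherian Q)
      (h.smul_mid.symm ▸ h.wcovBy_mid) h2 (h.smul_mid.symm ▸ hc)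
    refine h.not_le_right ?_
    rw [← h.smul_mid, ← hQ, ← map_smul'', map_le_iff_le_comap]
    intro x hx
    have hx1 : x.1 ∈ Ring.jacobson A • D :=
      smul_mono_right (Ring.jacobson A) hfst
        ((map_smul'' _ X (LinearMap.fst A M M)).le (mem_map_of_mem hx))
    rw [h.smul_bot, mem_bot] at hx1
    have := (mem_glueing.1 (hJ hx)).2
    rwa [hx1, zero_add] at this
  exact fun x hx => ⟨hfst (mem_map_of_mem hx), hsnd (mem_map_of_mem hx)⟩

lemma eq_glueing_of_prod_le (h : IsForkedChain P Q D S T) {X Y : Submodule A (M × M)}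
    (hY : Y ≤ P.prod Q) (hi : X ⊓ Y = glueing S T) (hX : Q.prod D ≤ X) :
    Y = glueing S T := by
  have hJ : Ring.jacobson A • Y ≤ glueing S T := by
    rw [← hi]
    exact le_inf (((smul_mono_right _ hY).trans h.jacobson_smul_prod_eq.le).trans hX) smul_le_right
  have hle : Y ≤ X := ((h.le_prod_of_jacobson_smul_le hY hJ).trans
    (prod_mono h.wcovBy_mid.le le_rfl)).trans hX
  rw [← hi, inf_eq_right.2 hle]

lemma eq_glueing_or_eq_glueing (h : IsForkedChain P Q D S T) {X Y : Submodule A (M × M)}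
    (hi : X ⊓ Y = glueing S T) (hs : X ⊔ Y = P.prod Q) :
    X = glueing S T ∨ Y = glueing S T := by
  have hXK : glueing S T ≤ X := hi.ge.trans inf_le_left
  have hYK : glueing S T ≤ Y := hi.ge.trans inf_le_right
  have hX : X ≤ P.prod Q := hs ▸ le_sup_left
  have hY : Y ≤ P.prod Q := hs ▸ le_sup_right
  have hKQ : glueing S T ≤ Q.prod D := h.glueing_le.trans (prod_mono h.wcovBy_mid.le le_rfl)
  have key : ∀ Z ≤ P.prod Q, glueing S T ≤ Z →
      ¬ Ring.jacobson A • Z ⊔ glueing S T ≤ D.prod D → Q.prod D ≤ Z := fun Z hZ hKZ hn => by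
    rw [← h.eq_of_glueing_le le_sup_right
      (sup_le ((smul_mono_right _ hZ).trans h.jacobson_smul_prod_eq.le) hKQ) hn]
    exact sup_le smul_le_right hKZ
  by_cases h1 : Ring.jacobson A • X ⊔ glueing S T ≤ D.prod D
  · by_cases h2 : Ring.jacobson A • Y ⊔ glueing S T ≤ D.prod D
    · have h3 : Q.prod D ≤ D.prod D := by
        rw [← h.jacobson_smul_prod_eq, ← hs, smul_sup]
        exact sup_le (le_sup_left.trans h1) (le_sup_left.trans h2)
      exact absurd (fun x hx => (h3 (show (x, (0 : M)) ∈ Q.prod D from ⟨hx, D.zero_mem⟩)).1)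
        h.mid_lt.not_ge
    · exact .inl (h.eq_glueing_of_prod_le hX (inf_comm X Y ▸ hi) (key Y hY hYK h2))
  · exact .inr (h.eq_glueing_of_prod_le hY hi (key X hX hXK h1))

lemma isIndecModule (h : IsForkedChain P Q D S T) :
    IsIndecModule A (P.prod Q ⧸ (glueing S T).submoduleOf (P.prod Q)) := by
  have hle := h.glueing_le_prod
  let e := subquotientOrderIso hle
  have hbot : (e ⊥ : Submodule A (M × M)) = glueing S T :=
    le_antisymm (e.le_symm_apply.1 bot_le : e ⊥ ≤ ⟨_, le_rfl, hle⟩) (e ⊥).2.1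
  have htop : (e ⊤ : Submodule A (M × M)) = P.prod Q :=
    le_antisymm (e ⊤).2.2 (e.symm_apply_le.1 le_top : ⟨_, hle, le_rfl⟩ ≤ e ⊤)
  have hlt : glueing S T < P.prod Q := by
    refine lt_of_le_not_ge hle fun hge => h.top_lt.not_ge fun x hx => ?_
    exact h.wcovBy_mid.le
      (h.glueing_le (hge (show (x, (0 : M)) ∈ P.prod Q from ⟨hx, Q.zero_mem⟩))).1
  have eq_bot : ∀ X, (e X : Submodule A (M × M)) = glueing S T → X = ⊥ := fun X hX =>
    e.injective (Subtype.ext (hX.trans hbot.symm))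
  refine ⟨?_, fun X Y hXY => ?_⟩
  · rw [← Submodule.nontrivial_iff A]
    refine ⟨⊥, ⊤, fun hbt => ?_⟩
    exact hlt.ne (hbot.symm.trans ((congrArg (fun Z => (e Z).1) hbt).trans htop))
  · have hi : (e X : Submodule A (M × M)) ⊓ e Y = glueing S T := by
      refine Eq.trans ?_ hbot
      rw [← hXY.inf_eq_bot]
      refine le_antisymm ?_ (le_inf (e.monotone inf_le_left) (e.monotone inf_le_right))
      let Z : Set.Icc (glueing S T) (P.prod Q) :=
        ⟨(e X).1 ⊓ (e Y).1, le_inf (e X).2.1 (e Y).2.1, inf_le_left.trans (e X).2.2⟩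
      have hX : Z ≤ e X := (inf_le_left : (e X).1 ⊓ (e Y).1 ≤ _)
      have hY : Z ≤ e Y := (inf_le_right : (e X).1 ⊓ (e Y).1 ≤ _)
      have hZ : Z ≤ e (X ⊓ Y) :=
        e.symm_apply_le.1 (le_inf (e.symm_apply_le.2 hX) (e.symm_apply_le.2 hY))
      exact hZ
    have hs : (e X : Submodule A (M × M)) ⊔ e Y = P.prod Q := by
      refine Eq.trans ?_ htop
      rw [← hXY.sup_eq_top]
      refine le_antisymm (sup_le (e.monotone le_sup_left) (e.monotone le_sup_right)) ?_
      let Z : Set.Icc (glueing S T) (P.prod Q) :=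
        ⟨(e X).1 ⊔ (e Y).1, (e X).2.1.trans le_sup_left, sup_le (e X).2.2 (e Y).2.2⟩
      have hX : e X ≤ Z := (le_sup_left : _ ≤ (e X).1 ⊔ (e Y).1)
      have hY : e Y ≤ Z := (le_sup_right : _ ≤ (e X).1 ⊔ (e Y).1)
      have hZ : e (X ⊔ Y) ≤ Z :=
        e.le_symm_apply.1 (sup_le (e.le_symm_apply.2 hX) (e.le_symm_apply.2 hY))
      exact hZ
    exact (h.eq_glueing_or_eq_glueing hi hs).imp (eq_bot X) (eq_bot Y)

end IsForkedChain

end Amalgam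

section Fork

variable {A : Type v} [Ring A] {M : Type w} [AddCommGroup M] [Module A M]

lemma isUniserialModule_quotient_radPow_one [IsArtinianRing A] [Module.Finite A M]
    (h : IsLocalModule A M) : IsUniserialModule A (M ⧸ radPow A M 1) := by
  obtain ⟨N, hN, huniq⟩ := h
  have hrad : radPow A M 1 = N := by
    rw [radPow_succ, radPow, ← moduleRad_eq, moduleRad]
    exact le_antisymm (sInf_le hN) (le_sInf fun K hK => (huniq K hK).ge)
  refine isUniserialModule_quotient_radPow fun i hi => ?_
  obtain rfl : i = 0 := by omega
  rw [hrad, radPow]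
  exact hN.covBy_top.wcovBy

lemma exists_isForkedChain [IsArtinianRing A] [Module.Finite A M] {k : ℕ}
    (hl : moduleLength A M = (k + 4 : ℕ))
    (h1 : IsUniserialModule A (M ⧸ radPow A M (k + 2)))
    (h2 : ¬ IsUniserialModule A (M ⧸ radPow A M (k + 3))) :
    ∃ S T, IsForkedChain (radPow A M k) (radPow A M (k + 1)) (radPow A M (k + 2)) S T := by
  have hcov : ∀ i < k + 2, radPow A M (i + 1) ⩿ radPow A M i := fun i hi => by
    rw [radPow_succ]
    refine jacobson_smul_wcovBy h1 ?_
    rw [← radPow_succ]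
    exact radPow_antitone hi
  have hn : ¬ radPow A M (k + 2 + 1) ⩿ radPow A M (k + 2) := fun hc => by
    refine h2 (isUniserialModule_quotient_radPow fun i hi => ?_)
    rcases Nat.lt_succ_iff_lt_or_eq.1 hi with hi | rfl
    · exact hcov i hi
    · exact hc
  obtain ⟨S, hS1, hS2⟩ : ∃ S, radPow A M (k + 2 + 1) < S ∧ S < radPow A M (k + 2) := by
    by_contra! hc
    exact hn ⟨radPow_antitone (Nat.le_succ _), hc⟩
  have hbot : radPow A M (k + 2 + 1) = ⊥ := by
    by_contra hne
    have hD := height_radPow_add_le (ne_bot_of_gt hS2)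
    have e0 : (1 : ℕ∞) ≤ Order.height (radPow A M (k + 2 + 1)) :=
      le_of_add_le_right (Order.height_add_one_le (bot_lt_iff_ne_bot.2 hne))
    have e1 := Order.height_add_one_le hS1
    have e2 := Order.height_add_one_le hS2
    have htop : Order.height (⊤ : Submodule A M) = (k + 4 : ℕ) := by
      have := Order.height_top_eq_krullDim (α := Submodule A M)
      rw [← moduleLength, hl] at this
      exact WithBot.coe_injective this
    rw [htop] at hD
    have : ((1 + 1 + 1 + (k + 2) : ℕ) : ℕ∞) ≤ (k + 4 : ℕ) := by
      refine le_trans ?_ hD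
      push_cast
      gcongr
      exact (add_le_add_left ((add_le_add_left e0 1).trans e1) 1).trans e2
    have := Nat.cast_le.1 this
    omega
  have hsmul : Ring.jacobson A • radPow A M (k + 2) = ⊥ := by rw [← radPow_succ, hbot]
  obtain ⟨T, -, hi, hs⟩ := exists_isCompl_of_jacobson_smul_eq_bot hsmul hS2.le
  exact ⟨S, T, {
    smul_top := (radPow_succ _).symm
    smul_mid := (radPow_succ _).symm
    smul_bot := hsmul
    wcovBy_top := hcov k (by omega)
    wcovBy_mid := hcov (k + 1) (by omega)
    inf_eq := hi
    sup_eq := hs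
    left_ne := ne_bot_of_gt hS1
    right_ne := by
      rintro rfl
      exact hS2.ne (by rw [← hs, sup_bot_eq]) }⟩

end Fork

end JacobsonFiltration

theorem length_of_local_two_factor_serial
    (R : Type*) [CommRing R] [IsArtinianRing R]
    (Λ : Type u) [Ring Λ] [Algebra R Λ] [Module.Finite R Λ]
    (hΛ : IsRightNNakayama Λ 4)
    (M : Type u) [AddCommGroup M] [Module Λᵐᵒᵖ M] [Module.Finite Λᵐᵒᵖ M]
    (hind : IsIndecModule Λᵐᵒᵖ M) (hloc : IsLocalModule Λᵐᵒᵖ M)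
    (hfs : IsNFactorSerial Λᵐᵒᵖ M 2) :
    moduleLength Λᵐᵒᵖ M = 3 := by
  have : IsArtinianRing Λᵐᵒᵖ := .of_finite R Λᵐᵒᵖ
  obtain ⟨-, -, l, hl, h2l, hu, hnu⟩ := hfs
  obtain rfl | rfl | ⟨k, rfl⟩ : l = 2 ∨ l = 3 ∨ ∃ k, l = k + 4 := by
    by_cases h4 : 4 ≤ l
    · exact .inr (.inr ⟨l - 4, by omega⟩)
    · omega
  · exact absurd (JacobsonFiltration.isUniserialModule_quotient_radPow_one hloc) hnu
  · exact hl
  · obtain ⟨S, T, h⟩ := JacobsonFiltration.exists_isForkedChain hl hu hnu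
    obtain ⟨i, -, hi, hf⟩ := hΛ.1 (ModuleCat.of _ _) inferInstance h.isIndecModule
    exact absurd (h.five_le_of_isFactorSerial hf) (by omega)
end
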